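/- Exact Hankel wave expansion (Theorem 2 with R → ∞): let N be an odd positive integer, h = 1/(N+1), u_0 ∈ ℝ^N, and j a positive integer. Define the Hankel wave H(j) = Σ_{k=1}^N cos(2j sin(kπ/(2(N+1)))) H_k u_0. Then all infinite series below converge absolutely and H(j) = (1/(2(N+1))) ( α e + β cos(2j) w ) − Σ_{k=1}^{2N−1} ( Σ_{ρ=0}^∞ J_{4ρ(N+1)+2k+2}(2j) ) (F_k + F_{2N−k}) u_0, where α = e·u_0 and β = w·u_0. -/

import Mathlib

open Real Matrix

/-- Bessel function of the first kind of nonnegative integer order n: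
J_n(t) = Σ_{m=0}^∞ ((−1)^m/(m!(n+m)!)) (t/2)^{n+2m}. -/
noncomputable def besselJ (n : ℕ) (t : ℝ) : ℝ :=
  ∑' m : ℕ, ((-1 : ℝ) ^ m / ((m.factorial : ℝ) * ((n + m).factorial : ℝ))) * (t / 2) ^ (n + 2 * m)

/-- Hankel part: (H_k)_{m,n} = −h cos((m+n) k π h), h = 1/(N+1), 1-based. -/
noncomputable def Hmat (N : ℕ) (k : Fin N) : Matrix (Fin N) (Fin N) ℝ :=
  fun m n => -(1 / (N + 1)) * Real.cos ((((m.1 : ℝ) + 1) + ((n.1 : ℝ) + 1)) * (k.1 + 1) * π / (N + 1))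

/-- The Hankel wave at time t = j Δt (with Δt = Δx):
H(j) = Σ_{k=1}^N cos(2j sin(kπ/(2(N+1)))) H_k u_0. -/
noncomputable def Hwave (N : ℕ) (u0 : Fin N → ℝ) (j : ℕ) : Fin N → ℝ :=
  ∑ k : Fin N,
    Real.cos (2 * (j : ℝ) * Real.sin ((k.1 + 1) * π / (2 * (N + 1)))) • (Hmat N k).mulVec u0

/-- F_k: ones on the k-th anti-diagonal, (F_k)_{m,n} = 1 if m + n = k + 1
(1-based m, n), 0 otherwise. -/
def Fmat (N : ℕ) (k : ℕ) : Matrix (Fin N) (Fin N) ℝ :=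
  fun m n => if (m.1 + 1) + (n.1 + 1) = k + 1 then 1 else 0

/-- e = (1,…,1)ᵀ. -/
def evec (N : ℕ) : Fin N → ℝ := fun _ => 1

/-- w_m = (−1)^{m+1} for 1-based m, i.e. (−1)^{m.1}. -/
def wvec (N : ℕ) : Fin N → ℝ := fun m => (-1 : ℝ) ^ m.1


def eqv : ℤ × ℕ ≃ ℕ × ℕ where
  toFun p := (p.1.toNat + p.2, (-p.1).toNat + p.2)
  invFun q := ((q.1 : ℤ) - q.2, min q.1 q.2)
  left_inv := by rintro ⟨n, m⟩; ext <;> simp <;> omega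
  right_inv := by rintro ⟨a, b⟩; ext <;> simp <;> omega

/-- double-series term of the generating function -/
noncomputable def gt (z t : ℂ) (p : ℤ × ℕ) : ℂ :=
  ((z * t) ^ (p.1.toNat + p.2) / ((p.1.toNat + p.2).factorial : ℂ)) *
  ((-z * t⁻¹) ^ ((-p.1).toNat + p.2) / (((-p.1).toNat + p.2).factorial : ℂ))

lemma exp_hasSum (w : ℂ) : HasSum (fun n : ℕ => w ^ n / (n.factorial : ℂ)) (Complex.exp w) := by
  rw [Complex.exp_eq_exp_ℂ]
  exact NormedSpace.expSeries_div_hasSum_exp _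

lemma hasSum_prod_aux (f g : ℕ → ℂ) (a b : ℂ) (h1 : HasSum f a) (h2 : HasSum g b) :
    HasSum (fun p : ℕ × ℕ => f p.1 * g p.2) (a * b) := by
  have h3 : Summable (fun p : ℕ × ℕ => f p.1 * g p.2) :=
    summable_mul_of_summable_norm h1.summable.norm h2.summable.norm
  exact HasSum.mul h1 h2 h3

lemma exp_hasSum_prod (w v : ℂ) :
    HasSum (fun p : ℕ × ℕ => w ^ p.1 / (p.1.factorial : ℂ) * (v ^ p.2 / (p.2.factorial : ℂ)))
      (Complex.exp w * Complex.exp v) := by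
  exact hasSum_prod_aux (fun n : ℕ => w ^ n / (n.factorial : ℂ))
    (fun n : ℕ => v ^ n / (n.factorial : ℂ)) _ _ (exp_hasSum w) (exp_hasSum v)

lemma gt_hasSum (z t : ℂ) : HasSum (gt z t) (Complex.exp (z * (t - t⁻¹))) := by
  have h3 := exp_hasSum_prod (z * t) (-z * t⁻¹)
  rw [← Complex.exp_add, show z * t + -z * t⁻¹ = z * (t - t⁻¹) by ring] at h3
  have h4 := (Equiv.hasSum_iff eqv).mpr h3
  refine h4.congr_fun ?_
  rintro ⟨n, m⟩
  simp only [gt, eqv, Function.comp, Equiv.coe_fn_mk]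

lemma gt_odd (z t : ℂ) (p : ℤ × ℕ) (hp : Odd p.1) : gt z t p + gt z (-t) p = 0 := by
  obtain ⟨n, m⟩ := p
  have e1 : z * -t = -(z * t) := by ring
  have e2 : -z * (-t)⁻¹ = -(-z * t⁻¹) := by rw [inv_neg]; ring
  unfold gt
  simp only [e1, e2]
  rw [neg_pow (z * t), neg_pow (-z * t⁻¹)]
  have : (-1 : ℂ) ^ (n.toNat + m) * (-1) ^ ((-n).toNat + m) = -1 := by
    rw [← pow_add]
    apply Odd.neg_one_pow
    obtain ⟨r, hr⟩ := hp
    simp only at hr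
    rcases le_total 0 n with h | h
    · refine ⟨r.toNat + m, by omega⟩
    · refine ⟨(-r-1).toNat + m, by omega⟩
  linear_combination (z * t) ^ (n.toNat + m) / ((n.toNat + m).factorial : ℂ) *
    ((-z * t⁻¹) ^ ((-n).toNat + m) / (((-n).toNat + m).factorial : ℂ)) * this

lemma gt_even (x : ℝ) (t : ℂ) (ht : t ≠ 0) (r : ℤ) (m : ℕ) :
    gt ((x / 2 : ℝ) : ℂ) t (2 * r, m) =
      ((((-1 : ℝ) ^ m / ((m.factorial : ℝ) * (((2 * r.natAbs) + m).factorial : ℝ))) *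
        (x / 2) ^ ((2 * r.natAbs) + 2 * m) : ℝ) : ℂ) * t ^ (2 * r) := by
  generalize x / 2 = z
  unfold gt
  obtain ⟨k, rfl | rfl⟩ := Int.eq_nat_or_neg r
  · have a1 : (2 * (k:ℤ)).toNat = 2 * k := by omega
    have a2 : (-(2 * (k:ℤ))).toNat = 0 := by omega
    have a3 : t ^ (2 * (k : ℤ)) = t ^ (2 * k) := by exact_mod_cast zpow_natCast t (2 * k)
    simp only [a1, a2, a3, Int.natAbs_natCast, zero_add]
    push_cast
    have : (t⁻¹) ^ m * t ^ m = 1 := by rw [← mul_pow, inv_mul_cancel₀ ht, one_pow]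
    have e : ((z : ℂ) * t) ^ (2 * k + m) * (-z * t⁻¹) ^ m
      = (-1) ^ m * z ^ (2 * k + 2 * m) * t ^ (2 * k) := by
      rw [neg_mul, neg_pow, mul_pow, mul_pow, pow_add t]
      linear_combination (z : ℂ) ^ (2 * k + m) * t ^ (2 * k) * (-1) ^ m * z ^ m * this
    rw [div_mul_div_comm, e]
    ring
  · have a1 : (2 * -(k:ℤ)).toNat = 0 := by omega
    have a2 : (-(2 * -(k:ℤ))).toNat = 2 * k := by omega
    have a3 : t ^ (2 * -(k : ℤ)) = t⁻¹ ^ (2 * k) := by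
      rw [mul_neg, _root_.zpow_neg, ← _root_.inv_zpow]; exact_mod_cast zpow_natCast t⁻¹ (2 * k)
    simp only [a1, a2, a3, Int.natAbs_neg, Int.natAbs_natCast, zero_add]
    push_cast
    have : (t⁻¹) ^ m * t ^ m = 1 := by rw [← mul_pow, inv_mul_cancel₀ ht, one_pow]
    have h1 : (-1 : ℂ) ^ (2 * k) = 1 := by simp
    have e : ((z : ℂ) * t) ^ m * (-z * t⁻¹) ^ (2 * k + m)
      = (-1) ^ m * z ^ (2 * k + 2 * m) * t⁻¹ ^ (2 * k) := by
      rw [neg_mul, neg_pow, mul_pow, mul_pow, pow_add t⁻¹, pow_add (-1 : ℂ), h1]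
      linear_combination (z : ℂ) ^ (2 * k + m) * t⁻¹ ^ (2 * k) * (-1) ^ m * z ^ m * this
    rw [div_mul_div_comm, e]
    ring

lemma jacobi_anger (x θ : ℝ) :
    HasSum (fun r : ℤ => besselJ (2 * r.natAbs) x * Real.cos (r * θ))
      (Real.cos (x * Real.sin (θ / 2))) := by
  set t : ℂ := Complex.exp ((θ / 2 : ℝ) * Complex.I) with ht
  have ht0 : t ≠ 0 := Complex.exp_ne_zero _
  have hti : t⁻¹ = Complex.exp (-((θ / 2 : ℝ) * Complex.I)) := by rw [ht, Complex.exp_neg]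
  have hsub : t - t⁻¹ = 2 * Complex.sin (θ / 2 : ℝ) * Complex.I := by
    rw [hti, ht, ← neg_mul, Complex.exp_mul_I, Complex.exp_mul_I, Complex.cos_neg, Complex.sin_neg]
    ring
  have hs := (gt_hasSum ((x / 2 : ℝ) : ℂ) t)
  have hs' := (gt_hasSum ((x / 2 : ℝ) : ℂ) (-t))
  have hadd := hs.add hs'
  have hval : Complex.exp (((x / 2 : ℝ) : ℂ) * (t - t⁻¹)) + Complex.exp (((x / 2 : ℝ) : ℂ) * (-t - (-t)⁻¹))
      = 2 * ((Real.cos (x * Real.sin (θ / 2)) : ℝ) : ℂ) := by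
    rw [inv_neg, show -t - -t⁻¹ = -(t - t⁻¹) by ring, hsub, Complex.ofReal_cos]
    rw [show ((x / 2 : ℝ) : ℂ) * (2 * Complex.sin (θ / 2 : ℝ) * Complex.I)
      = ((x * Real.sin (θ / 2) : ℝ) : ℂ) * Complex.I by push_cast; ring,
      show ((x / 2 : ℝ) : ℂ) * -(2 * Complex.sin (θ / 2 : ℝ) * Complex.I)
      = -((x * Real.sin (θ / 2) : ℝ) : ℂ) * Complex.I by push_cast; ring,
      Complex.exp_mul_I, Complex.exp_mul_I, Complex.cos_neg, Complex.sin_neg]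
    ring
  rw [hval] at hadd
  have hinj : Function.Injective (fun p : ℤ × ℕ => ((2 * p.1, p.2) : ℤ × ℕ)) := by
    rintro ⟨a, b⟩ ⟨c, d⟩ h
    simp only [Prod.mk.injEq] at h ⊢
    omega
  have h5 := (hinj.hasSum_iff (f := fun b => gt ((x / 2 : ℝ) : ℂ) t b + gt ((x / 2 : ℝ) : ℂ) (-t) b) (by
    rintro ⟨n, m⟩ hn
    apply gt_odd
    rw [← Int.not_even_iff_odd]
    rintro ⟨r, hr⟩
    exact hn ⟨(r, m), by simp only at hr ⊢; rw [hr]; congr 1; ring⟩)).mpr hadd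
  have h6 : HasSum (fun p : ℤ × ℕ => 2 * (((((-1 : ℝ) ^ p.2 / ((p.2.factorial : ℝ) *
      (((2 * p.1.natAbs) + p.2).factorial : ℝ))) *
        (x / 2) ^ ((2 * p.1.natAbs) + 2 * p.2) : ℝ) : ℂ) * t ^ (2 * p.1)))
      (2 * ((Real.cos (x * Real.sin (θ / 2)) : ℝ) : ℂ)) := by
    refine h5.congr_fun ?_
    rintro ⟨r, m⟩
    simp only [Function.comp]
    rw [gt_even x t ht0, gt_even x (-t) (neg_ne_zero.mpr ht0), Even.neg_zpow ⟨r, by ring⟩]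
    ring
  have h7 := h6.mul_left (1 / 2)
  have h8 := Complex.reCLM.hasSum h7
  have hre : ∀ r : ℤ, (t ^ (2 * r)).re = Real.cos (r * θ) := by
    intro r
    rw [ht, ← Complex.exp_int_mul]
    rw [show ((2 * r : ℤ) : ℂ) * ((θ / 2 : ℝ) * Complex.I) = ((r * θ : ℝ) : ℂ) * Complex.I by
      push_cast; ring, Complex.exp_ofReal_mul_I_re]
  have h9 : HasSum (fun p : ℤ × ℕ => (((-1 : ℝ) ^ p.2 / ((p.2.factorial : ℝ) *
      (((2 * p.1.natAbs) + p.2).factorial : ℝ))) *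
        (x / 2) ^ ((2 * p.1.natAbs) + 2 * p.2)) * Real.cos (p.1 * θ))
      (Real.cos (x * Real.sin (θ / 2))) := by
    convert h8 using 1
    · funext p
      simp only [Function.comp, Complex.reCLM_apply]
      rw [← mul_assoc, show (1 / 2 : ℂ) * 2 = 1 by norm_num, one_mul, Complex.re_ofReal_mul, hre]
    · simp only [Complex.reCLM_apply]
      rw [← mul_assoc, show (1 / 2 : ℂ) * 2 = 1 by norm_num, one_mul, Complex.ofReal_re]
  have h10 := h9.prod_fiberwise (fun r => (h9.summable.prod_factor r).hasSum)
  refine h10.congr_fun ?_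
  intro r
  simp only [besselJ]
  rw [tsum_mul_right]

lemma cos_sum_aux (α : ℝ) (n : ℕ) :
    2 * Real.sin (α / 2) * ∑ k ∈ Finset.range n, Real.cos ((k + 1) * α) =
      Real.sin ((n + 1 / 2) * α) - Real.sin (α / 2) := by
  induction n with
  | zero => simp; ring_nf
  | succ n ih =>
    rw [Finset.sum_range_succ, mul_add, ih]
    push_cast
    rw [show ((n : ℝ) + 1 + 1 / 2) * α = (n + 1) * α + α / 2 by ring,
      show ((n : ℝ) + 1 / 2) * α = (n + 1) * α - α / 2 by ring, Real.sin_add, Real.sin_sub]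
    ring

lemma cos_sum (N : ℕ) (q : ℤ) :
    ∑ k : Fin N, Real.cos (q * ((k.1 + 1) * π / (N + 1))) =
      (if (2 * ((N : ℤ) + 1)) ∣ q then ((N : ℝ) + 1) else 0) - (1 + Real.cos (q * π)) / 2 := by
  have hM : ((N : ℝ) + 1) ≠ 0 := by positivity
  split_ifs with h
  · obtain ⟨c, rfl⟩ := h
    have h1 : ∀ k : Fin N, Real.cos (((2 * ((N : ℤ) + 1) * c : ℤ) : ℝ) * ((k.1 + 1) * π / (N + 1))) = 1 := by
      intro k
      rw [show ((2 * ((N : ℤ) + 1) * c : ℤ) : ℝ) * ((k.1 + 1) * π / (N + 1))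
        = ((c * (k.1 + 1) : ℤ) : ℝ) * (2 * π) by push_cast; field_simp]
      exact Real.cos_int_mul_two_pi _
    have h2 : Real.cos (((2 * ((N : ℤ) + 1) * c : ℤ) : ℝ) * π) = 1 := by
      rw [show ((2 * ((N : ℤ) + 1) * c : ℤ) : ℝ) * π
        = (((N + 1) * c : ℤ) : ℝ) * (2 * π) by push_cast; ring]
      exact Real.cos_int_mul_two_pi _
    rw [Finset.sum_congr rfl (fun k _ => h1 k), h2]
    simp
  · have hs : Real.sin ((q * π / (N + 1)) / 2) ≠ 0 := by
      intro h0
      obtain ⟨c, hc⟩ := Real.sin_eq_zero_iff.mp h0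
      apply h
      refine ⟨c, ?_⟩
      have : (q : ℝ) = 2 * (N + 1) * c := by
        have hp := Real.pi_ne_zero
        field_simp at hc
        linarith
      exact_mod_cast this
    have h3 := cos_sum_aux (q * π / (N + 1)) N
    rw [show ((N : ℝ) + 1 / 2) * (q * π / (N + 1)) = q * π - (q * π / (N + 1)) / 2 by
      field_simp; ring, Real.sin_sub, Real.sin_int_mul_pi] at h3
    rw [Fin.sum_univ_eq_sum_range (fun k : ℕ => Real.cos (q * (((k : ℝ) + 1) * π / (N + 1)))) N]
    have h4 : ∀ k ∈ Finset.range N, Real.cos (q * (((k : ℝ) + 1) * π / (N + 1))) =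
        Real.cos (((k : ℝ) + 1) * (q * π / (N + 1))) := by
      intro k _; congr 1; ring
    rw [Finset.sum_congr rfl h4]
    apply mul_left_cancel₀ hs
    linear_combination h3 / 2

lemma bessel_summable (x : ℝ) : Summable (fun r : ℤ => besselJ (2 * r.natAbs) x) := by
  simpa using (jacobi_anger x 0).summable

lemma bessel_summable' (N : ℕ) (p : ℕ) (x : ℝ) :
    Summable (fun ρ : ℕ => besselJ (4 * ρ * (N + 1) + 2 * p) x) := by
  have hinj : Function.Injective (fun ρ : ℕ => ((2 * ρ * (N + 1) + p : ℕ) : ℤ)) := by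
    intro a b h
    have h' : 2 * a * (N + 1) + p = 2 * b * (N + 1) + p := by
      simp only at h
      exact_mod_cast h
    have h2 : (2 * a) * (N + 1) = (2 * b) * (N + 1) := by omega
    have := Nat.eq_of_mul_eq_mul_right (Nat.succ_pos N) h2
    omega
  have := (bessel_summable x).comp_injective hinj
  refine this.congr ?_
  intro ρ
  simp only [Function.comp, Int.natAbs_natCast]
  congr 1
  ring

noncomputable def Aser (N p : ℕ) (x : ℝ) : ℝ := ∑' ρ : ℕ, besselJ (4 * ρ * (N + 1) + 2 * p) x

lemma res_sum (N s : ℕ) (hs : s ≤ 2 * N) (x : ℝ) :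
    HasSum (fun r : ℤ => if (2 * ((N : ℤ) + 1)) ∣ (r - s) then besselJ (2 * r.natAbs) x else 0)
      (Aser N s x + Aser N (2 * N + 2 - s) x) := by
  have h1 := (bessel_summable' N s x).hasSum
  have h2 := (bessel_summable' N (2 * N + 2 - s) x).hasSum
  have h3 : HasSum (fun ρ : ℤ => besselJ (2 * (s + 2 * ((N : ℤ) + 1) * ρ).natAbs) x)
      (Aser N s x + Aser N (2 * N + 2 - s) x) := by
    apply HasSum.of_nat_of_neg_add_one
    · refine h1.congr_fun ?_
      intro ρ
      congr 1
      have : ((s : ℤ) + 2 * ((N : ℤ) + 1) * ρ) = ((s + 2 * (N + 1) * ρ : ℕ) : ℤ) := by push_cast; ring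
      rw [this, Int.natAbs_natCast]
      ring
    · refine h2.congr_fun ?_
      intro ρ
      congr 1
      have : ((s : ℤ) + 2 * ((N : ℤ) + 1) * (-(ρ + 1)))
          = -(((2 * N + 2 - s) + 2 * (N + 1) * ρ : ℕ) : ℤ) := by
        push_cast [show s ≤ 2 * N + 2 by omega]; ring
      rw [this, Int.natAbs_neg, Int.natAbs_natCast]
      ring
  have hinj : Function.Injective (fun ρ : ℤ => (s : ℤ) + 2 * ((N : ℤ) + 1) * ρ) := by
    intro a b h
    have h' : 2 * ((N : ℤ) + 1) * a = 2 * ((N : ℤ) + 1) * b := by simpa using h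
    exact mul_left_cancel₀ (by positivity) h'
  rw [← hinj.hasSum_iff]
  · refine h3.congr_fun ?_
    intro ρ
    simp
  · intro r hr
    rw [if_neg]
    rintro ⟨c, hc⟩
    exact hr ⟨c, by simp only; omega⟩

lemma entry (N s : ℕ) (hs : s ≤ 2 * N) (x : ℝ) :
    ∑ k : Fin N, Real.cos (x * Real.sin (((k.1 : ℝ) + 1) * π / (2 * (N + 1)))) *
      (-(1 / ((N : ℝ) + 1)) * Real.cos (s * ((k.1 + 1) * π / (N + 1)))) =
    1 / (2 * ((N : ℝ) + 1)) * (1 + Real.cos (s * π) * Real.cos x)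
      - (Aser N s x + Aser N (2 * N + 2 - s) x) := by
  have hM : ((N : ℝ) + 1) ≠ 0 := by positivity
  have h1 : HasSum (fun r : ℤ => ∑ k : Fin N,
      besselJ (2 * r.natAbs) x * Real.cos (r * (((k.1 : ℝ) + 1) * π / (N + 1))) *
        (-(1 / ((N : ℝ) + 1)) * Real.cos (s * ((k.1 + 1) * π / (N + 1)))))
      (∑ k : Fin N, Real.cos (x * Real.sin (((k.1 : ℝ) + 1) * π / (N + 1) / 2)) *
      (-(1 / ((N : ℝ) + 1)) * Real.cos (s * ((k.1 + 1) * π / (N + 1))))) :=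
    hasSum_sum (fun k _ => (jacobi_anger x _).mul_right _)
  have hA := res_sum N s hs x
  have hB := (Equiv.neg ℤ).hasSum_iff.mpr hA
  have h0 := jacobi_anger x 0
  have hpi := jacobi_anger x π
  have h2 := (((hA.add hB).mul_left (-(1 / 2 : ℝ))).add (h0.mul_left (1 / (2 * ((N : ℝ) + 1))))).add
    (hpi.mul_left (1 / (2 * ((N : ℝ) + 1)) * Real.cos (s * π)))
  have h3 := h1.unique (h2.congr_fun ?_)
  · rw [show (∑ k : Fin N, Real.cos (x * Real.sin (((k.1 : ℝ) + 1) * π / (2 * (N + 1)))) *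
      (-(1 / ((N : ℝ) + 1)) * Real.cos (s * ((k.1 + 1) * π / (N + 1))))) =
      (∑ k : Fin N, Real.cos (x * Real.sin (((k.1 : ℝ) + 1) * π / (N + 1) / 2)) *
      (-(1 / ((N : ℝ) + 1)) * Real.cos (s * ((k.1 + 1) * π / (N + 1))))) from ?_, h3]
    · simp
      ring
    · refine Finset.sum_congr rfl fun k _ => ?_
      rw [div_div, mul_comm ((N : ℝ) + 1) 2]
  · intro r
    have c1 := cos_sum N (r - s)
    have c2 := cos_sum N (-r - s)
    have key : ∀ k : Fin N, besselJ (2 * r.natAbs) x * Real.cos (r * (((k.1 : ℝ) + 1) * π / (N + 1))) *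
        (-(1 / ((N : ℝ) + 1)) * Real.cos (s * ((k.1 + 1) * π / (N + 1)))) =
        besselJ (2 * r.natAbs) x * (-(1 / (2 * ((N : ℝ) + 1)))) *
        (Real.cos (((r - s : ℤ) : ℝ) * ((k.1 + 1) * π / (N + 1))) +
         Real.cos (((-r - s : ℤ) : ℝ) * ((k.1 + 1) * π / (N + 1)))) := by
      intro k
      generalize ((k.1 : ℝ) + 1) * π / (N + 1) = θ
      push_cast
      rw [show (-(r : ℝ) - s) * θ = -(r * θ + s * θ) by ring, Real.cos_neg, sub_mul, Real.cos_sub,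
        Real.cos_add]
      field_simp
      ring
    rw [Finset.sum_congr rfl (fun k _ => key k), ← Finset.mul_sum, Finset.sum_add_distrib, c1, c2]
    have d1 : Real.cos (((r - s : ℤ) : ℝ) * π) = Real.cos (r * π) * Real.cos (s * π) := by
      push_cast
      rw [sub_mul, Real.cos_sub, Real.sin_int_mul_pi]; ring
    have d2 : Real.cos (((-r - s : ℤ) : ℝ) * π) = Real.cos (r * π) * Real.cos (s * π) := by
      push_cast
      rw [show (-(r : ℝ) - s) * π = -(r * π + s * π) by ring, Real.cos_neg, Real.cos_add,
        Real.sin_int_mul_pi]; ring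
    rw [d1, d2]
    simp only [Function.comp, Equiv.neg_apply, Int.natAbs_neg, mul_zero, Real.cos_zero]
    split_ifs <;> field_simp <;> ring

/-- Exact Hankel wave expansion (Theorem 2 with R → ∞): for odd
positive N and integer j ≥ 1, all Bessel series converge absolutely and
H(j) = (1/(2(N+1)))(α e + β cos(2j) w)
  − Σ_{k=1}^{2N−1} (Σ_{ρ≥0} J_{4ρ(N+1)+2k+2}(2j)) (F_k + F_{2N−k}) u_0,
with α = e·u_0, β = w·u_0. -/
theorem stmt18 (N : ℕ) (hN : 0 < N) (hNodd : Odd N) (u0 : Fin N → ℝ)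
    (j : ℕ) (hj : 1 ≤ j) :
    (∀ k : ℕ, 1 ≤ k → k ≤ 2 * N - 1 →
      Summable (fun ρ : ℕ => |besselJ (4 * ρ * (N + 1) + 2 * k + 2) (2 * (j : ℝ))|)) ∧
    Hwave N u0 j =
      (1 / (2 * ((N : ℝ) + 1)))
          • ((evec N ⬝ᵥ u0) • evec N + ((wvec N ⬝ᵥ u0) * Real.cos (2 * (j : ℝ))) • wvec N)
      - ∑ k ∈ Finset.range (2 * N - 1),
          (∑' ρ : ℕ, besselJ (4 * ρ * (N + 1) + 2 * (k + 1) + 2) (2 * (j : ℝ)))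
            • (Fmat N (k + 1) + Fmat N (2 * N - (k + 1))).mulVec u0 := by
  constructor
  · intro k _ _
    have := (bessel_summable' N (k + 1) (2 * (j : ℝ))).abs
    refine this.congr ?_
    intro ρ
    rw [show 4 * ρ * (N + 1) + 2 * (k + 1) = 4 * ρ * (N + 1) + 2 * k + 2 by ring]
  · have hA : ∀ k : ℕ, (∑' ρ : ℕ, besselJ (4 * ρ * (N + 1) + 2 * (k + 1) + 2) (2 * (j : ℝ)))
        = Aser N (k + 2) (2 * (j : ℝ)) := fun k => rfl
    simp only [hA]
    funext m
    simp only [Hwave, Finset.sum_apply, Pi.smul_apply, Pi.sub_apply, Pi.add_apply, smul_eq_mul,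
      Matrix.mulVec, dotProduct, evec, wvec, Matrix.add_apply, Finset.mul_sum]
    rw [Finset.sum_comm, Finset.sum_comm (s := Finset.range (2 * N - 1)), Finset.sum_mul,
      Finset.sum_mul, Finset.sum_mul, ← Finset.sum_add_distrib, Finset.mul_sum, ← Finset.sum_sub_distrib]
    refine Finset.sum_congr rfl fun n _ => ?_
    have hm := m.2
    have hn := n.2
    have he := entry N (m.1 + n.1 + 2) (by omega) (2 * (j : ℝ))
    have hcos : Real.cos (((m.1 + n.1 + 2 : ℕ) : ℝ) * π) = (-1) ^ m.1 * (-1) ^ n.1 := by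
      rw [Real.cos_nat_mul_pi, pow_add, pow_add]; norm_num
    rw [hcos] at he
    have hL : ∑ k : Fin N, Real.cos (2 * (j : ℝ) * Real.sin ((k.1 + 1) * π / (2 * (N + 1)))) *
        (Hmat N k m n * u0 n) = (∑ k : Fin N, Real.cos (2 * (j : ℝ) * Real.sin (((k.1 : ℝ) + 1) * π / (2 * (N + 1)))) *
      (-(1 / ((N : ℝ) + 1)) * Real.cos (((m.1 + n.1 + 2 : ℕ) : ℝ) * ((k.1 + 1) * π / (N + 1))))) * u0 n := by
      rw [Finset.sum_mul]
      refine Finset.sum_congr rfl fun k _ => ?_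
      rw [Hmat, ← mul_assoc]
      congr 4
      push_cast
      ring_nf
    have hR : ∑ k ∈ Finset.range (2 * N - 1), Aser N (k + 2) (2 * (j : ℝ)) *
        ((Fmat N (k + 1) m n + Fmat N (2 * N - (k + 1)) m n) * u0 n) =
        (Aser N (m.1 + n.1 + 2) (2 * (j : ℝ)) + Aser N (2 * N + 2 - (m.1 + n.1 + 2)) (2 * (j : ℝ))) * u0 n := by
      have e1 : ∀ k ∈ Finset.range (2 * N - 1), Aser N (k + 2) (2 * (j : ℝ)) *
        ((Fmat N (k + 1) m n + Fmat N (2 * N - (k + 1)) m n) * u0 n) =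
        ((if k = m.1 + n.1 then Aser N (k + 2) (2 * (j : ℝ)) else 0) +
         (if k = 2 * N - 2 - (m.1 + n.1) then Aser N (k + 2) (2 * (j : ℝ)) else 0)) * u0 n := by
        intro k hk
        rw [Finset.mem_range] at hk
        have f1 : Fmat N (k + 1) m n = if k = m.1 + n.1 then 1 else 0 := by
          unfold Fmat; congr 1; apply propext; omega
        have f2 : Fmat N (2 * N - (k + 1)) m n = if k = 2 * N - 2 - (m.1 + n.1) then 1 else 0 := by
          unfold Fmat; congr 1; apply propext; omega
        rw [f1, f2]
        split_ifs <;> ring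
      rw [Finset.sum_congr rfl e1, ← Finset.sum_mul, Finset.sum_add_distrib, Finset.sum_ite_eq',
        Finset.sum_ite_eq', if_pos (Finset.mem_range.mpr (by omega)),
        if_pos (Finset.mem_range.mpr (by omega)),
        show 2 * N - 2 - (m.1 + n.1) + 2 = 2 * N + 2 - (m.1 + n.1 + 2) by omega]
    rw [hL, hR, he]
    ring
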